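/- Let p ≥ 1 be an integer, τ > 0, and a, b ∈ ℂ^p with Σ_{j=1}^p a_j = Σ_{j=1}^p b_j. Fix ε ∈ (0, π/2) and c ∈ ℝ with c > max_{1≤j≤p} Re(b_j) − τ − 1. Then for every z > 1 the two integrals I_±(z) := ∫₀^∞ 𝒢^{0,p}_{p,p}(a;b | c + t·e^{±iε}; τ) · exp(−(c + t·e^{±iε})·log(z)) dt converge absolutely and (1/(2πi))·( e^{iε}·I_+(z) − e^{−iε}·I_−(z) ) = 0; that is, the Mellin–Barnes integral of 𝒢^{0,p}_{p,p}(a;b|s;τ)·z^{−s} over the contour consisting of the ray from ∞·e^{−iε}+c down to c followed by the ray from c to ∞·e^{iε}+c vanishes (this quantity is the K-function K^{0,p}_{p,p}(a;b|z;τ) of the logarithmic case). Here 𝒢^{0,p}_{p,p}(a;b|s;τ) = ∏_{j=1}^p G(1+τ−a_j+s;τ) / ∏_{j=1}^p G(1+τ−b_j+s;τ). -/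

import Mathlib

open Complex Filter MeasureTheory Set

noncomputable section

/-- The digamma function ψ = Γ'/Γ. -/
def digammaC (z : ℂ) : ℂ := deriv Complex.Gamma z / Complex.Gamma z

/-- The gamma modular form C(τ). -/
def gammaModC (τ : ℂ) : ℂ :=
  limUnder atTop fun M : ℕ =>
    (∑ k ∈ Finset.Ico 1 M, digammaC (k * τ)) + digammaC (M * τ) / 2
      - (1 / τ) * Complex.log (Complex.Gamma (M * τ) / (Real.sqrt (2 * Real.pi) : ℂ))

/-- The gamma modular form D(τ). -/
def gammaModD (τ : ℂ) : ℂ :=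
  limUnder atTop fun M : ℕ =>
    (∑ k ∈ Finset.Ico 1 M, deriv digammaC (k * τ)) + deriv digammaC (M * τ) / 2
      - (1 / τ) * digammaC (M * τ)

def aBarnes (τ : ℂ) : ℂ :=
  -(Real.eulerMascheroniConstant : ℂ) * τ + (τ / 2) * Complex.log (2 * Real.pi * τ)
    + (1 / 2) * Complex.log τ - τ * gammaModC τ

def bBarnes (τ : ℂ) : ℂ :=
  -(Real.pi : ℂ) ^ 2 * τ ^ 2 / 6 - τ * Complex.log τ - τ ^ 2 * gammaModD τ

/-- The Barnes double gamma function `G(z;τ)`, via its Weierstrass product. -/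
def barnesG (z τ : ℂ) : ℂ :=
  z / τ * Complex.exp (aBarnes τ * z / τ + bBarnes τ * z ^ 2 / (2 * τ)) *
    ∏' mn : ℕ × ℕ,
      if mn = (0, 0) then 1
      else (1 + z / (mn.1 * τ + mn.2)) *
        Complex.exp (-(z / (mn.1 * τ + mn.2)) + z ^ 2 / (2 * ((mn.1 : ℂ) * τ + (mn.2 : ℂ)) ^ 2))

/-- The ratio of Barnes double gamma functions `𝒢^{m,n}_{p,q}(a;b | s;τ)`. -/
def calG (m n : ℕ) {p q : ℕ} (a : Fin p → ℂ) (b : Fin q → ℂ) (s τ : ℂ) : ℂ :=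
  ((∏ j : Fin q, if (j : ℕ) < m then barnesG (b j - s) τ else 1) *
      ∏ j : Fin p, if (j : ℕ) < n then barnesG (1 + τ - a j + s) τ else 1) /
    ((∏ j : Fin q, if m ≤ (j : ℕ) then barnesG (1 + τ - b j + s) τ else 1) *
      ∏ j : Fin p, if n ≤ (j : ℕ) then barnesG (a j - s) τ else 1)

/-- The Weierstrass primary factor of genus two. -/
def primaryFactor (x : ℂ) : ℂ := (1 + x) * exp (-x + x ^ 2 / 2)

lemma differentiable_primaryFactor : Differentiable ℂ primaryFactor := by
  unfold primaryFactor
  fun_prop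

lemma primaryFactor_zero : primaryFactor 0 = 1 := by simp [primaryFactor]

lemma primaryFactor_ne_zero {x : ℂ} (hx : 1 + x ≠ 0) : primaryFactor x ≠ 0 :=
  mul_ne_zero hx (exp_ne_zero _)

lemma primaryFactor_sub_one_isBigO :
    (fun x => primaryFactor x - 1) =O[nhds 0] fun x : ℂ => x ^ 3 := by
  have h0 : Tendsto (fun x : ℂ => -x + x ^ 2 / 2) (nhds 0) (nhds 0) := by
    have : Continuous fun x : ℂ => -x + x ^ 2 / 2 := by fun_prop
    simpa using this.tendsto 0
  have h1 := (Complex.exp_sub_sum_range_isBigO_pow 3).comp_tendsto h0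
  have h2 : (fun x : ℂ => (-x + x ^ 2 / 2) ^ 3) =O[nhds 0] fun x : ℂ => x ^ 3 := by
    have hc : Continuous fun x : ℂ => (-1 + x / 2) ^ 3 := by fun_prop
    have h3 := (hc.tendsto 0).isBigO_one ℂ |>.mul
      (Asymptotics.isBigO_refl (fun x : ℂ => x ^ 3) (nhds 0))
    refine (h3.congr_left fun x => ?_).congr_right fun x => ?_ <;> ring
  have hc1 : Continuous fun x : ℂ => 1 + x := by fun_prop
  have h4 := (hc1.tendsto 0).isBigO_one ℂ |>.mul (h1.trans h2)
  have hc2 : Continuous fun x : ℂ => (1 / 2 - 3 * x / 8 + x ^ 2 / 8) := by fun_prop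
  have h5 := (hc2.tendsto 0).isBigO_one ℂ |>.mul
    (Asymptotics.isBigO_refl (fun x : ℂ => x ^ 3) (nhds 0))
  simp only [one_mul] at h4 h5
  refine (h4.add h5).congr_left fun x => ?_
  simp only [primaryFactor, Function.comp, Finset.sum_range_succ, Finset.sum_range_zero]
  norm_num [Nat.factorial]
  ring

lemma primaryFactor_inv_sub_one_isBigO :
    (fun x => (primaryFactor x)⁻¹ - 1) =O[nhds 0] fun x : ℂ => x ^ 3 := by
  have hc : Tendsto primaryFactor (nhds 0) (nhds 1) := by
    simpa [primaryFactor_zero] using differentiable_primaryFactor.continuous.tendsto 0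
  have h1 := ((hc.inv₀ one_ne_zero).neg.isBigO_one ℂ).mul primaryFactor_sub_one_isBigO
  simp only [one_mul] at h1
  refine h1.congr' ?_ .rfl
  filter_upwards [hc.eventually_ne one_ne_zero] with x hx
  field_simp
  ring

lemma exists_norm_sub_one_le_pow {g : ℂ → ℂ} {K : Set ℂ} (hK : IsCompact K)
    (hg : ContinuousOn g K) (hO : (fun x => g x - 1) =O[nhds 0] fun x : ℂ => x ^ 3) :
    ∃ C, 0 ≤ C ∧ ∀ x ∈ K, ‖g x - 1‖ ≤ C * ‖x‖ ^ 3 := by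
  obtain ⟨c, hc⟩ := hO.bound
  obtain ⟨δ, hδ, hball⟩ := Metric.eventually_nhds_iff.1 hc
  obtain ⟨N, hN⟩ := hK.exists_bound_of_continuousOn (hg.sub (continuousOn_const (c := (1 : ℂ))))
  refine ⟨max |c| (|N| / δ ^ 3), by positivity, fun x hx => ?_⟩
  by_cases hxδ : ‖x‖ < δ
  · have := hball (y := x) (by simpa using hxδ)
    rw [norm_pow] at this
    refine this.trans ?_
    gcongr
    exact (le_abs_self c).trans (le_max_left _ _)
  · calc ‖g x - 1‖ ≤ |N| := (hN x hx).trans (le_abs_self N)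
      _ = |N| / δ ^ 3 * δ ^ 3 := by field_simp
      _ ≤ max |c| (|N| / δ ^ 3) * ‖x‖ ^ 3 := by
        gcongr
        · exact le_max_right _ _
        · exact not_lt.1 hxδ

lemma norm_le_exp_of_norm_sub_one_le {x : ℂ} {r : ℝ} (h : ‖x - 1‖ ≤ r) : ‖x‖ ≤ Real.exp r := by
  have h1 : ‖x‖ ≤ ‖x - 1‖ + 1 := by simpa using norm_add_le (x - 1) 1
  linarith [Real.add_one_le_exp r]

lemma exists_primaryFactor_sub_one_le (M : ℝ) :
    ∃ C, 0 ≤ C ∧ ∀ x : ℂ, ‖x‖ ≤ M → ‖primaryFactor x - 1‖ ≤ C * ‖x‖ ^ 3 := by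
  obtain ⟨C, hC, h⟩ := exists_norm_sub_one_le_pow (isCompact_closedBall (0 : ℂ) M)
    differentiable_primaryFactor.continuous.continuousOn primaryFactor_sub_one_isBigO
  exact ⟨C, hC, fun x hx => h x (by simpa using hx)⟩

lemma exists_primaryFactor_inv_sub_one_le (M : ℝ) {k : ℝ} (hk : 0 < k) :
    ∃ C, 0 ≤ C ∧ ∀ x : ℂ, ‖x‖ ≤ M → k ≤ ‖1 + x‖ →
      ‖(primaryFactor x)⁻¹ - 1‖ ≤ C * ‖x‖ ^ 3 := by
  have hK : IsCompact (Metric.closedBall (0 : ℂ) M ∩ {x | k ≤ ‖1 + x‖}) :=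
    (isCompact_closedBall (0 : ℂ) M).inter_right
      (isClosed_le continuous_const (by fun_prop))
  obtain ⟨C, hC, h⟩ := exists_norm_sub_one_le_pow hK
    (differentiable_primaryFactor.continuous.continuousOn.inv₀ fun x hx =>
      primaryFactor_ne_zero (norm_pos_iff.1 (hk.trans_le hx.2)))
    primaryFactor_inv_sub_one_isBigO
  exact ⟨C, hC, fun x hx hx' => h x ⟨by simpa using hx, hx'⟩⟩

/-- The lattice points `mτ + n` indexing the double product. -/
def latticePt (τ : ℝ) (mn : ℕ × ℕ) : ℝ := mn.1 * τ + mn.2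

lemma latticePt_zero (τ : ℝ) : latticePt τ (0, 0) = 0 := by simp [latticePt]

lemma le_latticePt {τ : ℝ} (hτ : 0 < τ) (mn : ℕ × ℕ) :
    min τ 1 * max (mn.1 : ℝ) mn.2 ≤ latticePt τ mn := by
  have h1 : min τ 1 ≤ τ := min_le_left _ _
  have h2 : min τ 1 ≤ 1 := min_le_right _ _
  have h3 : 0 < min τ 1 := by positivity
  have h4 : (0 : ℝ) ≤ mn.1 := Nat.cast_nonneg _
  have h5 : (0 : ℝ) ≤ mn.2 := Nat.cast_nonneg _
  unfold latticePt
  rcases max_cases (mn.1 : ℝ) mn.2 with h | h <;> rw [h.1] <;> nlinarith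

lemma min_le_latticePt {τ : ℝ} (hτ : 0 < τ) {mn : ℕ × ℕ} (h : mn ≠ (0, 0)) :
    min τ 1 ≤ latticePt τ mn := by
  refine le_trans ?_ (le_latticePt hτ mn)
  have h3 : 0 < min τ 1 := by positivity
  refine le_mul_of_one_le_right h3.le ?_
  obtain ⟨m, n⟩ := mn
  have : 1 ≤ m ∨ 1 ≤ n := by
    simp only [ne_eq, Prod.mk.injEq] at h
    omega
  rcases this with h | h
  · exact le_max_of_le_left (by exact_mod_cast h)
  · exact le_max_of_le_right (by exact_mod_cast h)

lemma latticePt_nonneg {τ : ℝ} (hτ : 0 < τ) (mn : ℕ × ℕ) : 0 ≤ latticePt τ mn := by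
  unfold latticePt
  positivity

lemma latticePt_pos {τ : ℝ} (hτ : 0 < τ) {mn : ℕ × ℕ} (h : mn ≠ (0, 0)) :
    0 < latticePt τ mn :=
  lt_of_lt_of_le (by positivity) (min_le_latticePt hτ h)

lemma summable_latticePt {τ : ℝ} (hτ : 0 < τ) :
    Summable fun mn : ℕ × ℕ => 1 / latticePt τ mn ^ 3 := by
  have h := EisensteinSeries.summable_one_div_norm_rpow (k := 3) (by norm_num)
  let i : ℕ × ℕ → (Fin 2 → ℤ) := fun mn => ![(mn.1 : ℤ), (mn.2 : ℤ)]
  have hi : Function.Injective i := by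
    rintro ⟨a, b⟩ ⟨c, d⟩ h
    have h0 := congrFun h 0
    have h1 := congrFun h 1
    simpa [i] using And.intro h0 h1
  have h3 : 0 < min τ 1 := by positivity
  refine Summable.of_nonneg_of_le
    (fun mn => div_nonneg zero_le_one (pow_nonneg (latticePt_nonneg hτ mn) 3)) (fun mn => ?_)
    ((h.comp_injective hi).mul_left (1 / min τ 1 ^ 3))
  have hn : ‖i mn‖ = max (mn.1 : ℝ) mn.2 := by
    have h4 : (0 : ℝ) ≤ mn.1 := Nat.cast_nonneg _
    have h5 : (0 : ℝ) ≤ mn.2 := Nat.cast_nonneg _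
    simp [i, Pi.norm_def, Finset.univ_fin2]
  simp only [Function.comp, hn]
  by_cases hmn : mn = (0, 0)
  · subst hmn
    simp [latticePt]
  have hpos : 0 < max (mn.1 : ℝ) mn.2 := by
    obtain ⟨m, n⟩ := mn
    have : 0 < m ∨ 0 < n := by
      simp only [Prod.mk.injEq] at hmn
      omega
    simpa [lt_max_iff] using this
  rw [Real.rpow_neg hpos.le, show (3 : ℝ) = (3 : ℕ) by norm_num, Real.rpow_natCast, ← one_div,
    one_div_mul_one_div, ← mul_pow]
  have := le_latticePt hτ mn
  gcongr

lemma exists_primaryFactor_lattice_bound {τ : ℝ} (hτ : 0 < τ) (R : ℝ) :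
    ∃ C, 0 ≤ C ∧ ∀ z : ℂ, ‖z‖ ≤ R → ∀ mn,
      ‖primaryFactor (z / latticePt τ mn) - 1‖ ≤ C * (1 / latticePt τ mn ^ 3) := by
  obtain ⟨C, hC, h⟩ := exists_primaryFactor_sub_one_le (R / min τ 1)
  have h3 : 0 < min τ 1 := by positivity
  refine ⟨C * |R| ^ 3, by positivity, fun z hz mn => ?_⟩
  have hR : ‖z‖ ≤ |R| := hz.trans (le_abs_self R)
  have hR0 : 0 ≤ R := (norm_nonneg z).trans hz
  by_cases hmn : mn = (0, 0)
  · simp [hmn, latticePt_zero, primaryFactor_zero]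
  have hl := latticePt_pos hτ hmn
  have hn : ‖z / latticePt τ mn‖ = ‖z‖ / latticePt τ mn := by
    simp [abs_of_pos hl]
  refine (h _ ?_).trans ?_
  · rw [hn]
    have := min_le_latticePt hτ hmn
    gcongr
  · rw [hn, div_pow, mul_one_div, mul_div_assoc]
    gcongr

/-- The infinite product in the definition of the Barnes double gamma function. -/
def latticeProd (τ : ℝ) (z : ℂ) : ℂ := ∏' mn : ℕ × ℕ, primaryFactor (z / latticePt τ mn)

lemma summable_norm_primaryFactor {τ : ℝ} (hτ : 0 < τ) (z : ℂ) :
    Summable fun mn : ℕ × ℕ => ‖primaryFactor (z / latticePt τ mn) - 1‖ := by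
  obtain ⟨C, _, h⟩ := exists_primaryFactor_lattice_bound hτ ‖z‖
  exact Summable.of_nonneg_of_le (fun _ => norm_nonneg _) (h z le_rfl)
    ((summable_latticePt hτ).mul_left C)

lemma hasProd_latticeProd {τ : ℝ} (hτ : 0 < τ) (z : ℂ) :
    HasProd (fun mn : ℕ × ℕ => primaryFactor (z / latticePt τ mn)) (latticeProd τ z) := by
  have h := multipliable_one_add_of_summable (summable_norm_primaryFactor hτ z)
  simp only [add_sub_cancel] at h
  exact h.hasProd

lemma one_add_div_latticePt_ne_zero {τ : ℝ} (hτ : 0 < τ) {z : ℂ} (hz : 0 < z.re) (mn : ℕ × ℕ) :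
    1 + z / latticePt τ mn ≠ 0 := by
  intro h
  have h1 := congrArg Complex.re h
  simp only [add_re, one_re, div_ofReal_re, zero_re] at h1
  have := div_nonneg hz.le (latticePt_nonneg hτ mn)
  linarith

lemma latticeProd_ne_zero {τ : ℝ} (hτ : 0 < τ) {z : ℂ} (hz : 0 < z.re) :
    latticeProd τ z ≠ 0 := by
  have h := tprod_one_add_ne_zero_of_summable
    (f := fun mn : ℕ × ℕ => primaryFactor (z / latticePt τ mn) - 1)
    (fun mn => by
      simpa using primaryFactor_ne_zero (one_add_div_latticePt_ne_zero hτ hz mn))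
    (summable_norm_primaryFactor hτ z)
  simpa [latticeProd] using h

lemma differentiable_latticeProd {τ : ℝ} (hτ : 0 < τ) : Differentiable ℂ (latticeProd τ) := by
  intro z
  obtain ⟨C, _, h⟩ := exists_primaryFactor_lattice_bound hτ (‖z‖ + 1)
  have hd : ∀ mn : ℕ × ℕ, Differentiable ℂ fun z : ℂ => primaryFactor (z / latticePt τ mn) :=
    fun mn => differentiable_primaryFactor.comp (by fun_prop)
  have hp := Summable.hasProdLocallyUniformlyOn_one_add
    (f := fun (mn : ℕ × ℕ) (z : ℂ) => primaryFactor (z / latticePt τ mn) - 1)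
    (Metric.isOpen_ball (x := (0 : ℂ)) (ε := ‖z‖ + 1)) ((summable_latticePt hτ).mul_left C)
    (Eventually.of_forall fun mn x hx => h x (by simpa using (Metric.mem_ball.1 hx).le) mn)
    (fun mn => ((hd mn).sub_const 1).continuous.continuousOn)
  simp only [add_sub_cancel] at hp
  have h2 := TendstoLocallyUniformlyOn.differentiableOn
    (hasProdLocallyUniformlyOn_iff_tendstoLocallyUniformlyOn.1 hp)
    (Eventually.of_forall fun s => by
      have : Differentiable ℂ fun b : ℂ => ∏ mn ∈ s, primaryFactor (b / latticePt τ mn) :=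
        Differentiable.fun_finsetProd fun i _ => hd i
      exact this.differentiableOn) Metric.isOpen_ball
  exact h2.differentiableAt (Metric.isOpen_ball.mem_nhds (by simp))

lemma barnesG_eq (τ : ℝ) (z : ℂ) :
    barnesG z τ = z / τ * exp (aBarnes τ * z / τ + bBarnes τ * z ^ 2 / (2 * τ)) *
      latticeProd τ z := by
  unfold barnesG latticeProd
  congr 1
  refine tprod_congr fun mn => ?_
  by_cases h : mn = (0, 0)
  · simp [h, latticePt_zero, primaryFactor_zero]
  · rw [if_neg h, primaryFactor]
    simp only [latticePt, ofReal_add, ofReal_mul, ofReal_natCast]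
    congr 3
    rw [div_pow, div_div, mul_comm (2 : ℂ)]

lemma differentiable_barnesG {τ : ℝ} (hτ : 0 < τ) : Differentiable ℂ fun z => barnesG z τ := by
  simp only [barnesG_eq]
  exact Differentiable.mul (by fun_prop) (differentiable_latticeProd hτ)

lemma barnesG_ne_zero {τ : ℝ} (hτ : 0 < τ) {z : ℂ} (hz : 0 < z.re) : barnesG z τ ≠ 0 := by
  rw [barnesG_eq]
  exact mul_ne_zero (mul_ne_zero (div_ne_zero (ne_zero_of_re_pos hz)
    (ofReal_ne_zero.2 hτ.ne')) (exp_ne_zero _)) (latticeProd_ne_zero hτ hz)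

lemma primaryFactor_shift {l w σ u : ℂ} (hl : l ≠ 0) (hw : w ≠ 0) (h : w = l + σ) :
    primaryFactor ((σ + u) / l) = w / l * primaryFactor (u / w) *
      exp ((-σ / l + σ ^ 2 / (2 * l ^ 2)) + (1 / w - 1 / l + σ / l ^ 2) * u +
        (1 / (2 * l ^ 2) - 1 / (2 * w ^ 2)) * u ^ 2) := by
  have h1 : 1 + (σ + u) / l = w / l * (1 + u / w) := by
    field_simp
    rw [h]
    ring
  rw [primaryFactor, primaryFactor, h1, mul_assoc, mul_assoc, mul_assoc, ← exp_add]
  congr 3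
  field_simp
  ring

lemma prod_primaryFactor_ratio {ι : Type*} [Fintype ι] {u v : ι → ℂ}
    (huv : ∑ j, u j = ∑ j, v j) {l w σ : ℂ} (hl : l ≠ 0) (hw : w ≠ 0) (h : w = l + σ) :
    (∏ j, primaryFactor ((σ + u j) / l)) / ∏ j, primaryFactor ((σ + v j) / l) =
      (∏ j, primaryFactor (u j / w)) * (∏ j, (primaryFactor (v j / w))⁻¹) *
        exp ((1 / (2 * l ^ 2) - 1 / (2 * w ^ 2)) * (∑ j, (u j ^ 2 - v j ^ 2))) := by
  have h1 : ∑ j, (1 / w - 1 / l + σ / l ^ 2) * (u j - v j) = 0 := by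
    rw [← Finset.mul_sum, Finset.sum_sub_distrib, huv, sub_self, mul_zero]
  rw [← add_zero ((1 / (2 * l ^ 2) - 1 / (2 * w ^ 2)) * (∑ j, (u j ^ 2 - v j ^ 2))), ← h1,
    Finset.mul_sum, ← Finset.sum_add_distrib, exp_sum, ← Finset.prod_div_distrib,
    ← Finset.prod_mul_distrib, ← Finset.prod_mul_distrib]
  refine Finset.prod_congr rfl fun j _ => ?_
  rw [primaryFactor_shift hl hw h, primaryFactor_shift hl hw h, mul_div_mul_comm,
    mul_div_mul_left _ _ (div_ne_zero hw hl), ← exp_sub, div_eq_mul_inv]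
  congr 2
  ring

lemma exists_norm_primaryFactor_div_le {m : ℝ} (hm : 0 < m) (u : ℂ) :
    ∃ D, 0 ≤ D ∧ ∀ (w : ℂ) (l : ℝ), m ≤ l → l ≤ ‖w‖ →
      ‖primaryFactor (u / w)‖ ≤ Real.exp (D * (1 / l ^ 3)) := by
  obtain ⟨C, hC, h⟩ := exists_primaryFactor_sub_one_le (‖u‖ / m)
  refine ⟨C * ‖u‖ ^ 3, by positivity, fun w l hml hlw => ?_⟩
  have hl := hm.trans_le hml
  refine norm_le_exp_of_norm_sub_one_le ((h _ ?_).trans ?_)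
  · rw [norm_div]
    gcongr
    exact hml.trans hlw
  · rw [norm_div, div_pow, mul_one_div, mul_div_assoc]
    gcongr

lemma exists_norm_primaryFactor_div_inv_le {m k : ℝ} (hm : 0 < m) (hk : 0 < k) (v : ℂ) :
    ∃ D, 0 ≤ D ∧ ∀ (w : ℂ) (l : ℝ), m ≤ l → l ≤ ‖w‖ → k * ‖w‖ ≤ ‖w + v‖ →
      ‖(primaryFactor (v / w))⁻¹‖ ≤ Real.exp (D * (1 / l ^ 3)) := by
  obtain ⟨C, hC, h⟩ := exists_primaryFactor_inv_sub_one_le (‖v‖ / m) hk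
  refine ⟨C * ‖v‖ ^ 3, by positivity, fun w l hml hlw hwv => ?_⟩
  have hl := hm.trans_le hml
  have hw := hl.trans_le hlw
  refine norm_le_exp_of_norm_sub_one_le ((h _ ?_ ?_).trans ?_)
  · rw [norm_div]
    gcongr
    exact hml.trans hlw
  · have : 1 + v / w = (w + v) / w := by
      have := norm_pos_iff.1 hw
      field_simp
    rwa [this, norm_div, le_div_iff₀ hw]
  · rw [norm_div, div_pow, mul_one_div, mul_div_assoc]
    gcongr

lemma norm_inv_sq_sub_inv_sq_le {l k : ℝ} (hl : 0 < l) (hk : 0 < k) {σ : ℂ}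
    (hw : k * (l + ‖σ‖) ≤ ‖l + σ‖) :
    ‖1 / (2 * (l : ℂ) ^ 2) - 1 / (2 * (l + σ) ^ 2)‖ ≤
      1 / k ^ 2 * (‖σ‖ / (l ^ 2 * (l + ‖σ‖))) := by
  have hp : 0 < l + ‖σ‖ := by positivity
  have hw0 : 0 < ‖l + σ‖ := lt_of_lt_of_le (by positivity) hw
  have hlc : (l : ℂ) ≠ 0 := ofReal_ne_zero.2 hl.ne'
  have hwc : (l : ℂ) + σ ≠ 0 := norm_pos_iff.1 hw0
  have h1 : 1 / (2 * (l : ℂ) ^ 2) - 1 / (2 * (l + σ) ^ 2) =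
      σ * (2 * l + σ) / (2 * l ^ 2 * (l + σ) ^ 2) := by
    field_simp
    ring
  have h2 : ‖2 * (l : ℂ) + σ‖ ≤ 2 * (l + ‖σ‖) := by
    refine (norm_add_le _ _).trans ?_
    rw [norm_mul, norm_real, Real.norm_of_nonneg hl.le, RCLike.norm_ofNat]
    linarith [norm_nonneg σ]
  rw [h1, norm_div, norm_mul, norm_mul, norm_mul, norm_pow, norm_pow, norm_real,
    Real.norm_of_nonneg hl.le, RCLike.norm_ofNat]
  calc ‖σ‖ * ‖2 * (l : ℂ) + σ‖ / (2 * l ^ 2 * ‖l + σ‖ ^ 2)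
      ≤ ‖σ‖ * (2 * (l + ‖σ‖)) / (2 * l ^ 2 * (k * (l + ‖σ‖)) ^ 2) := by gcongr
    _ = 1 / k ^ 2 * (‖σ‖ / (l ^ 2 * (l + ‖σ‖))) := by field_simp

/-- The majorant of the logarithm of one factor of the quotient of lattice products. -/
def latticeMajorant (l t : ℝ) : ℝ := 1 / l ^ 3 + t / (l ^ 2 * (l + t))

lemma exists_norm_prod_primaryFactor_ratio_le {ι : Type*} [Fintype ι] {u v : ι → ℂ}
    (huv : ∑ j, u j = ∑ j, v j) (hv : ∀ j, 0 < (v j).re) {τ : ℝ} (hτ : 0 < τ) {k : ℝ}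
    (hk : 0 < k) (hk1 : k ≤ 1) :
    ∃ K, 0 ≤ K ∧ ∀ (mn : ℕ × ℕ) (σ : ℂ), k * ‖σ‖ ≤ σ.re →
      ‖(∏ j, primaryFactor ((σ + u j) / latticePt τ mn)) /
        ∏ j, primaryFactor ((σ + v j) / latticePt τ mn)‖ ≤
          Real.exp (K * latticeMajorant (latticePt τ mn) ‖σ‖) := by
  have hm : 0 < min τ 1 := by positivity
  choose D hD0 hD using fun j => exists_norm_primaryFactor_div_le hm (u j)
  choose D' hD0' hD' using fun j => exists_norm_primaryFactor_div_inv_le hm hk (v j)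
  set κ := ∑ j, (u j ^ 2 - v j ^ 2)
  have hS : 0 ≤ ∑ j, D j := Finset.sum_nonneg fun j _ => hD0 j
  have hS' : 0 ≤ ∑ j, D' j := Finset.sum_nonneg fun j _ => hD0' j
  have hκ' : 0 ≤ 1 / k ^ 2 * ‖κ‖ := by positivity
  refine ⟨(∑ j, D j) + (∑ j, D' j) + 1 / k ^ 2 * ‖κ‖, by positivity, fun mn σ hσ => ?_⟩
  by_cases hmn : mn = (0, 0)
  · simp [hmn, latticePt_zero, primaryFactor_zero, latticeMajorant]
  set l := latticePt τ mn
  have hml : min τ 1 ≤ l := min_le_latticePt hτ hmn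
  have hl : 0 < l := latticePt_pos hτ hmn
  have hσn := norm_nonneg σ
  have hre : l + k * ‖σ‖ ≤ ((l : ℂ) + σ).re := by simpa using hσ
  have hnorm : ((l : ℂ) + σ).re ≤ ‖(l : ℂ) + σ‖ := re_le_norm _
  have hnorm' : ‖(l : ℂ) + σ‖ ≤ l + ‖σ‖ := by
    simpa [abs_of_pos hl] using norm_add_le (l : ℂ) σ
  have hlw : l ≤ ‖(l : ℂ) + σ‖ := by nlinarith
  have hkw : k * (l + ‖σ‖) ≤ ((l : ℂ) + σ).re := by nlinarith
  have hw0 : (l : ℂ) + σ ≠ 0 := norm_pos_iff.1 (hl.trans_le hlw)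
  have hwv : ∀ j, k * ‖(l : ℂ) + σ‖ ≤ ‖(l : ℂ) + σ + v j‖ := fun j => by
    have h1 := re_le_norm ((l : ℂ) + σ + v j)
    rw [add_re] at h1
    have h2 := mul_le_mul_of_nonneg_left hnorm' hk.le
    linarith [hv j]
  rw [prod_primaryFactor_ratio huv (ofReal_ne_zero.2 hl.ne') hw0 rfl, norm_mul, norm_mul,
    norm_prod, norm_prod]
  have e1 : ∏ j, ‖primaryFactor (u j / (l + σ))‖ ≤ Real.exp ((∑ j, D j) * (1 / l ^ 3)) := by
    rw [Finset.sum_mul, Real.exp_sum]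
    exact Finset.prod_le_prod (fun _ _ => norm_nonneg _) fun j _ => hD j _ l hml hlw
  have e2 : ∏ j, ‖(primaryFactor (v j / (l + σ)))⁻¹‖ ≤
      Real.exp ((∑ j, D' j) * (1 / l ^ 3)) := by
    rw [Finset.sum_mul, Real.exp_sum]
    exact Finset.prod_le_prod (fun _ _ => norm_nonneg _) fun j _ => hD' j _ l hml hlw (hwv j)
  have e3 : ‖exp ((1 / (2 * (l : ℂ) ^ 2) - 1 / (2 * (l + σ) ^ 2)) * κ)‖ ≤
      Real.exp (1 / k ^ 2 * ‖κ‖ * (‖σ‖ / (l ^ 2 * (l + ‖σ‖)))) := by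
    refine (norm_exp_le_exp_norm _).trans (Real.exp_le_exp.2 ?_)
    rw [norm_mul]
    have := norm_inv_sq_sub_inv_sq_le hl hk (hkw.trans hnorm)
    calc _ ≤ 1 / k ^ 2 * (‖σ‖ / (l ^ 2 * (l + ‖σ‖))) * ‖κ‖ := by gcongr
      _ = _ := by ring
  calc _ ≤ Real.exp ((∑ j, D j) * (1 / l ^ 3)) * Real.exp ((∑ j, D' j) * (1 / l ^ 3)) *
        Real.exp (1 / k ^ 2 * ‖κ‖ * (‖σ‖ / (l ^ 2 * (l + ‖σ‖)))) := by gcongr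
    _ ≤ _ := by
      rw [← Real.exp_add, ← Real.exp_add]
      refine Real.exp_le_exp.2 ?_
      have p1 : 0 ≤ 1 / l ^ 3 := by positivity
      have p2 : 0 ≤ ‖σ‖ / (l ^ 2 * (l + ‖σ‖)) := by positivity
      unfold latticeMajorant
      nlinarith [mul_nonneg hS p2, mul_nonneg hS' p2, mul_nonneg hκ' p1]

lemma latticeMajorant_nonneg {l t : ℝ} (hl : 0 ≤ l) (ht : 0 ≤ t) : 0 ≤ latticeMajorant l t := by
  unfold latticeMajorant
  positivity

lemma tail_le_inv_cube {l t : ℝ} (hl : 0 ≤ l) (ht : 0 ≤ t) :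
    1 / (l ^ 2 * (l + t)) ≤ 1 / l ^ 3 := by
  rcases hl.eq_or_lt with rfl | hl
  · simp
  · apply one_div_le_one_div_of_le (by positivity)
    nlinarith [mul_nonneg (sq_nonneg l) ht]

lemma summable_tail {τ : ℝ} (hτ : 0 < τ) {t : ℝ} (ht : 0 ≤ t) :
    Summable fun mn => 1 / (latticePt τ mn ^ 2 * (latticePt τ mn + t)) := by
  refine Summable.of_nonneg_of_le (fun mn => ?_)
    (fun mn => tail_le_inv_cube (latticePt_nonneg hτ mn) ht) (summable_latticePt hτ)
  have := latticePt_nonneg hτ mn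
  positivity

lemma latticeMajorant_eq (l t : ℝ) :
    latticeMajorant l t = 1 / l ^ 3 + t * (1 / (l ^ 2 * (l + t))) := by
  rw [latticeMajorant, mul_one_div]

lemma summable_latticeMajorant {τ : ℝ} (hτ : 0 < τ) {t : ℝ} (ht : 0 ≤ t) :
    Summable fun mn => latticeMajorant (latticePt τ mn) t := by
  simp only [latticeMajorant_eq]
  exact (summable_latticePt hτ).add ((summable_tail hτ ht).mul_left t)

lemma tendsto_tail {τ : ℝ} (hτ : 0 < τ) :
    Tendsto (fun t : ℝ => ∑' mn, 1 / (latticePt τ mn ^ 2 * (latticePt τ mn + t))) atTop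
      (nhds 0) := by
  rw [← tsum_zero (α := ℝ) (β := ℕ × ℕ)]
  refine tendsto_tsum_of_dominated_convergence (summable_latticePt hτ) (fun mn => ?_) ?_
  · by_cases hmn : mn = (0, 0)
    · simp [hmn, latticePt_zero]
    have hl := latticePt_pos hτ hmn
    refine Tendsto.div_atTop tendsto_const_nhds ?_
    exact (tendsto_atTop_add_const_left _ _ tendsto_id).const_mul_atTop (by positivity)
  · filter_upwards [eventually_ge_atTop 0] with t ht mn
    have hl := latticePt_nonneg hτ mn
    rw [Real.norm_of_nonneg (by positivity)]
    exact tail_le_inv_cube hl ht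

lemma exists_tsum_latticeMajorant_le {τ : ℝ} (hτ : 0 < τ) {δ : ℝ} (hδ : 0 < δ) :
    ∃ A, ∀ t, 0 ≤ t → ∑' mn, latticeMajorant (latticePt τ mn) t ≤ A + δ * t := by
  obtain ⟨T, hT⟩ := eventually_atTop.1 ((tendsto_tail hτ).eventually_le_const hδ)
  set S := ∑' mn, 1 / latticePt τ mn ^ 3 with hS
  have hS0 : 0 ≤ S := tsum_nonneg fun mn => by
    have := latticePt_nonneg hτ mn
    positivity
  refine ⟨S + |T| * S, fun t ht => ?_⟩
  simp only [latticeMajorant_eq]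
  rw [(summable_latticePt hτ).tsum_add ((summable_tail hτ ht).mul_left t), tsum_mul_left, ← hS,
    add_assoc]
  gcongr
  by_cases h : T ≤ t
  · have := mul_le_mul_of_nonneg_left (hT t h) ht
    have : 0 ≤ |T| * S := by positivity
    linarith
  · have h1 : ∑' mn, 1 / (latticePt τ mn ^ 2 * (latticePt τ mn + t)) ≤ S :=
      (summable_tail hτ ht).tsum_le_tsum
        (fun mn => tail_le_inv_cube (latticePt_nonneg hτ mn) ht) (summable_latticePt hτ)
    have h2 : t ≤ |T| := (not_le.1 h).le.trans (le_abs_self T)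
    have := mul_le_mul_of_nonneg_left h1 ht
    have := mul_le_mul_of_nonneg_right h2 hS0
    have := mul_nonneg hδ.le ht
    linarith

lemma re_add_pos {k : ℝ} (hk : 0 < k) {σ v : ℂ} (hσ : k * ‖σ‖ ≤ σ.re) (hv : 0 < v.re) :
    0 < (σ + v).re := by
  rw [add_re]
  have := norm_nonneg σ
  nlinarith

lemma exists_norm_latticeProd_ratio_le {ι : Type*} [Fintype ι] {u v : ι → ℂ}
    (huv : ∑ j, u j = ∑ j, v j) (hv : ∀ j, 0 < (v j).re) {τ : ℝ} (hτ : 0 < τ) {k : ℝ}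
    (hk : 0 < k) (hk1 : k ≤ 1) {δ : ℝ} (hδ : 0 < δ) :
    ∃ C, 0 ≤ C ∧ ∀ σ : ℂ, k * ‖σ‖ ≤ σ.re →
      ‖(∏ j, latticeProd τ (σ + u j)) / ∏ j, latticeProd τ (σ + v j)‖ ≤
        C * Real.exp (δ * ‖σ‖) := by
  obtain ⟨K, hK, hb⟩ := exists_norm_prod_primaryFactor_ratio_le huv hv hτ hk hk1
  obtain ⟨A, hA⟩ := exists_tsum_latticeMajorant_le hτ (δ := δ / (K + 1)) (by positivity)
  refine ⟨Real.exp (K * A), (Real.exp_pos _).le, fun σ hσ => ?_⟩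
  have hlim : Tendsto (fun s : Finset (ℕ × ℕ) =>
      (∏ j, ∏ mn ∈ s, primaryFactor ((σ + u j) / latticePt τ mn)) /
        ∏ j, ∏ mn ∈ s, primaryFactor ((σ + v j) / latticePt τ mn)) atTop
      (nhds ((∏ j, latticeProd τ (σ + u j)) / ∏ j, latticeProd τ (σ + v j))) := by
    refine Tendsto.div (tendsto_finsetProd _ fun j _ => hasProd_latticeProd hτ _)
      (tendsto_finsetProd _ fun j _ => hasProd_latticeProd hτ _) ?_
    exact Finset.prod_ne_zero_iff.2 fun j _ => latticeProd_ne_zero hτ (re_add_pos hk hσ (hv j))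
  refine le_of_tendsto hlim.norm (Eventually.of_forall fun s => ?_)
  rw [Finset.prod_comm, Finset.prod_comm (s := Finset.univ) (t := s), ← Finset.prod_div_distrib,
    norm_prod]
  calc _ ≤ ∏ mn ∈ s, Real.exp (K * latticeMajorant (latticePt τ mn) ‖σ‖) :=
        Finset.prod_le_prod (fun _ _ => norm_nonneg _) fun mn _ => hb mn σ hσ
    _ = Real.exp (K * ∑ mn ∈ s, latticeMajorant (latticePt τ mn) ‖σ‖) := by
        rw [← Real.exp_sum, Finset.mul_sum]
    _ ≤ Real.exp (K * (A + δ / (K + 1) * ‖σ‖)) := by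
        gcongr
        exact ((summable_latticeMajorant hτ (norm_nonneg σ)).sum_le_tsum s fun mn _ =>
          latticeMajorant_nonneg (latticePt_nonneg hτ mn) (norm_nonneg σ)).trans
          (hA _ (norm_nonneg σ))
    _ ≤ _ := by
        rw [← Real.exp_add]
        refine Real.exp_le_exp.2 ?_
        have h1 : K * (δ / (K + 1)) ≤ δ := by
          rw [mul_div_assoc', div_le_iff₀ (by positivity)]
          nlinarith
        nlinarith [mul_le_mul_of_nonneg_right h1 (norm_nonneg σ)]

lemma norm_add_div_add_le {k : ℝ} (hk : 0 < k) {σ u v : ℂ} (hσ : k * ‖σ‖ ≤ σ.re)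
    (hv : 0 < v.re) : ‖(σ + u) / (σ + v)‖ ≤ 1 + ‖u - v‖ / v.re := by
  have hp := re_add_pos hk hσ hv
  have h0 : σ + v ≠ 0 := ne_zero_of_re_pos hp
  have h1 : (σ + u) / (σ + v) = 1 + (u - v) / (σ + v) := by
    field_simp
    ring
  have h2 : v.re ≤ ‖σ + v‖ := by
    refine le_trans ?_ (re_le_norm _)
    rw [add_re]
    nlinarith [norm_nonneg σ]
  rw [h1]
  refine (norm_add_le _ _).trans ?_
  rw [norm_one, norm_div]
  gcongr

lemma exists_norm_prod_barnesG_ratio_le {ι : Type*} [Fintype ι] {u v : ι → ℂ}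
    (huv : ∑ j, u j = ∑ j, v j) (hv : ∀ j, 0 < (v j).re) {τ : ℝ} (hτ : 0 < τ) {k : ℝ}
    (hk : 0 < k) (hk1 : k ≤ 1) {δ : ℝ} (hδ : 0 < δ) :
    ∃ C, 0 ≤ C ∧ ∀ σ : ℂ, k * ‖σ‖ ≤ σ.re →
      ‖(∏ j, barnesG (σ + u j) τ) / ∏ j, barnesG (σ + v j) τ‖ ≤
        C * Real.exp (δ * ‖σ‖) := by
  obtain ⟨C, hC, h⟩ := exists_norm_latticeProd_ratio_le huv hv hτ hk hk1 hδ
  set κ := ∑ j, (u j ^ 2 - v j ^ 2) with hκ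
  have hprod : 0 ≤ ∏ j, (1 + ‖u j - v j‖ / (v j).re) :=
    Finset.prod_nonneg fun j _ => by have := hv j; positivity
  refine ⟨(∏ j, (1 + ‖u j - v j‖ / (v j).re)) * ‖exp (bBarnes τ / (2 * τ) * κ)‖ * C,
    by positivity, fun σ hσ => ?_⟩
  have hfac : (∏ j, barnesG (σ + u j) τ) / ∏ j, barnesG (σ + v j) τ =
      (∏ j, (σ + u j) / (σ + v j)) * exp (bBarnes τ / (2 * τ) * κ) *
        ((∏ j, latticeProd τ (σ + u j)) / ∏ j, latticeProd τ (σ + v j)) := by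
    have h1 : ∑ j, (aBarnes τ / τ + bBarnes τ * σ / τ) * (u j - v j) = 0 := by
      rw [← Finset.mul_sum, Finset.sum_sub_distrib, huv, sub_self, mul_zero]
    rw [← add_zero (bBarnes τ / (2 * τ) * κ), ← h1, hκ, Finset.mul_sum,
      ← Finset.sum_add_distrib, exp_sum, ← Finset.prod_div_distrib, ← Finset.prod_div_distrib,
      ← Finset.prod_mul_distrib, ← Finset.prod_mul_distrib]
    refine Finset.prod_congr rfl fun j _ => ?_
    have hτ' : (τ : ℂ) ≠ 0 := ofReal_ne_zero.2 hτ.ne'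
    rw [barnesG_eq, barnesG_eq, mul_div_mul_comm, mul_div_mul_comm, ← exp_sub,
      div_div_div_cancel_right₀ hτ']
    congr 3
    field_simp
    ring
  rw [hfac, norm_mul, norm_mul, norm_prod, mul_assoc _ C]
  have := h σ hσ
  gcongr
  exact norm_add_div_add_le hk hσ (hv _)

lemma calG_zero_eq {p : ℕ} (a b : Fin p → ℂ) (s τ : ℂ) :
    calG 0 p a b s τ = (∏ j, barnesG (1 + τ - a j + s) τ) / ∏ j, barnesG (1 + τ - b j + s) τ := by
  simp [calG, Nat.not_le.2 (Fin.is_lt _)]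

lemma mem_sector {ε θ t : ℝ} (hε : ε ≤ Real.pi) (hθ : |θ| ≤ ε) (ht : 0 ≤ t) :
    Real.cos ε * ‖(t : ℂ) * exp (θ * I)‖ ≤ ((t : ℂ) * exp (θ * I)).re := by
  rw [norm_mul, norm_exp_ofReal_mul_I, norm_real, Real.norm_of_nonneg ht, re_ofReal_mul,
    exp_ofReal_mul_I_re, mul_one, mul_comm]
  gcongr
  rw [← Real.cos_abs θ]
  exact Real.cos_le_cos_of_nonneg_of_le_pi (abs_nonneg θ) hε hθ

lemma exp_ofReal_add_mul_I (x θ : ℝ) : exp (x + θ * I) = (Real.exp x : ℂ) * exp (θ * I) := by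
  rw [exp_add, ofReal_exp]

section Sector

variable {f : ℂ → ℂ} {ε C d : ℝ}

lemma integrableOn_ray (hε : ε ≤ Real.pi)
    (hf : ∀ σ : ℂ, Real.cos ε * ‖σ‖ ≤ σ.re → DifferentiableAt ℂ f σ) (hd : 0 < d)
    (hb : ∀ σ : ℂ, Real.cos ε * ‖σ‖ ≤ σ.re → ‖f σ‖ ≤ C * Real.exp (-d * ‖σ‖))
    {θ : ℝ} (hθ : |θ| ≤ ε) :
    IntegrableOn (fun t : ℝ => f (t * exp (θ * I))) (Ioi 0) := by
  have hc : ContinuousOn (fun t : ℝ => f (t * exp (θ * I))) (Ioi 0) := fun t ht =>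
    ((hf _ (mem_sector hε hθ (le_of_lt ht))).continuousAt.comp
      (f := fun t : ℝ => (t : ℂ) * exp (θ * I)) (by fun_prop)).continuousWithinAt
  refine Integrable.mono' ((integrableOn_exp_mul_Ioi (neg_lt_zero.2 hd) 0).const_mul C)
    (hc.aestronglyMeasurable measurableSet_Ioi) ?_
  filter_upwards [ae_restrict_mem measurableSet_Ioi] with t ht
  have := hb _ (mem_sector hε hθ (le_of_lt ht))
  rwa [norm_mul, norm_exp_ofReal_mul_I, norm_real, Real.norm_of_nonneg (le_of_lt ht),
    mul_one] at this

lemma tendsto_integral_log_ray {h : ℝ → ℂ} (hc : ContinuousOn h (Ioi 0))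
    (hi : IntegrableOn h (Ioi 0)) :
    Tendsto (fun R : ℝ => ∫ x in (-R)..R, (Real.exp x : ℂ) * h (Real.exp x)) atTop
      (nhds (∫ t in Ioi 0, h t)) := by
  have hcov : AECover (volume.restrict (Ioi (0 : ℝ))) atTop
      fun R : ℝ => Ioc (Real.exp (-R)) (Real.exp R) :=
    (aecover_Ioi_of_Ioi (Real.tendsto_exp_atBot.comp tendsto_neg_atTop_atBot)).inter
      (aecover_Iic Real.tendsto_exp_atTop)
  refine (hcov.integral_tendsto_of_countably_generated hi).congr' ?_
  filter_upwards [eventually_ge_atTop 0] with R hR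
  have hle : Real.exp (-R) ≤ Real.exp R := Real.exp_le_exp.2 (by linarith)
  have hsub : Ioc (Real.exp (-R)) (Real.exp R) ⊆ Ioi 0 := fun t ht =>
    (Real.exp_pos _).trans ht.1
  rw [Measure.restrict_restrict measurableSet_Ioc, inter_eq_left.2 hsub,
    ← intervalIntegral.integral_of_le hle]
  have := intervalIntegral.integral_deriv_smul_comp' (a := -R) (b := R) (f := Real.exp)
    (f' := Real.exp) (g := h) (fun x _ => Real.hasDerivAt_exp x) Real.continuous_exp.continuousOn
    (hc.mono (by rintro _ ⟨x, _, rfl⟩; exact Real.exp_pos x))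
  rw [← this]
  simp

lemma integral_ray_eq (hε0 : 0 ≤ ε) (hε : ε ≤ Real.pi)
    (hf : ∀ σ : ℂ, Real.cos ε * ‖σ‖ ≤ σ.re → DifferentiableAt ℂ f σ) (hd : 0 < d)
    (hb : ∀ σ : ℂ, Real.cos ε * ‖σ‖ ≤ σ.re → ‖f σ‖ ≤ C * Real.exp (-d * ‖σ‖)) :
    exp (ε * I) * (∫ t : ℝ in Ioi 0, f (t * exp (ε * I))) =
      exp (-(ε * I)) * ∫ t : ℝ in Ioi 0, f (t * exp (-(ε * I))) := by
  set g : ℂ → ℂ := fun ζ => f (exp ζ) * exp ζ with hg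
  have hsec : ∀ x θ : ℝ, |θ| ≤ ε → Real.cos ε * ‖exp (x + θ * I)‖ ≤ (exp (x + θ * I)).re := by
    intro x θ hθ
    rw [exp_ofReal_add_mul_I]
    exact mem_sector hε hθ (Real.exp_pos x).le
  have hgb : ∀ x θ : ℝ, |θ| ≤ ε →
      ‖g (x + θ * I)‖ ≤ C * Real.exp (-d * Real.exp x) * Real.exp x := by
    intro x θ hθ
    have hn : ‖exp (x + θ * I)‖ = Real.exp x := by simp [norm_exp]
    have := hb _ (hsec x θ hθ)
    rw [hg, norm_mul, hn]
    rw [hn] at this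
    gcongr
  have hC : 0 ≤ C := by
    have := (norm_nonneg _).trans (hb 0 (by simp))
    simpa using this
  have hlim : ∀ θ : ℝ, |θ| ≤ ε → Tendsto (fun R : ℝ => ∫ x : ℝ in (-R)..R, g (x + θ * I)) atTop
      (nhds (exp (θ * I) * ∫ t : ℝ in Ioi 0, f (t * exp (θ * I)))) := by
    intro θ hθ
    have hc : ContinuousOn (fun t : ℝ => f (t * exp (θ * I))) (Ioi 0) := fun t ht =>
      ((hf _ (mem_sector hε hθ (le_of_lt ht))).continuousAt.comp
        (f := fun t : ℝ => (t : ℂ) * exp (θ * I)) (by fun_prop)).continuousWithinAt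
    refine ((tendsto_integral_log_ray hc (integrableOn_ray hε hf hd hb hθ)).const_mul
      (exp (θ * I))).congr fun R => ?_
    rw [← intervalIntegral.integral_const_mul]
    refine intervalIntegral.integral_congr fun x _ => ?_
    simp only [hg, exp_ofReal_add_mul_I]
    ring
  have hrect : ∀ R : ℝ,
      (∫ x : ℝ in (-R)..R, g (x + (-ε : ℝ) * I)) - (∫ x : ℝ in (-R)..R, g (x + ε * I)) +
        I • (∫ y : ℝ in (-ε)..ε, g (R + y * I)) -
        I • (∫ y : ℝ in (-ε)..ε, g ((-R : ℝ) + y * I)) = 0 := by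
    intro R
    have := integral_boundary_rect_eq_zero_of_differentiableOn g ⟨-R, -ε⟩ ⟨R, ε⟩ ?_
    · exact this
    · rintro ζ ⟨-, hζ⟩
      simp only [mem_preimage, uIcc_of_le (neg_le_self hε0)] at hζ
      have hs := hsec ζ.re ζ.im (abs_le.2 hζ)
      rw [re_add_im] at hs
      exact (((hf _ hs).comp ζ differentiableAt_exp).mul
        differentiableAt_exp).differentiableWithinAt
  have hside : ∀ x : ℝ, ‖∫ y : ℝ in (-ε)..ε, g (x + y * I)‖ ≤
      C * Real.exp (-d * Real.exp x) * Real.exp x * |ε - -ε| := fun x =>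
    intervalIntegral.norm_integral_le_of_norm_le_const fun y hy => by
      rw [uIoc_of_le (neg_le_self hε0)] at hy
      exact hgb x y (abs_le.2 ⟨hy.1.le, hy.2⟩)
  have hside1 : Tendsto (fun R : ℝ => ∫ y : ℝ in (-ε)..ε, g (R + y * I)) atTop (nhds 0) := by
    refine squeeze_zero_norm hside ?_
    have h1 : Tendsto (fun y : ℝ => y * Real.exp (-d * y)) atTop (nhds 0) := by
      simpa using tendsto_rpow_mul_exp_neg_mul_atTop_nhds_zero 1 d hd
    have h2 := ((h1.comp Real.tendsto_exp_atTop).const_mul C).mul_const |ε - -ε|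
    simp only [mul_zero, zero_mul] at h2
    refine h2.congr fun R => ?_
    simp only [Function.comp]
    ring
  have hside2 : Tendsto (fun R : ℝ => ∫ y : ℝ in (-ε)..ε, g ((-R : ℝ) + y * I)) atTop
      (nhds 0) := by
    have h1 : Tendsto (fun R : ℝ => Real.exp (-R)) atTop (nhds 0) :=
      Real.tendsto_exp_atBot.comp tendsto_neg_atTop_atBot
    have h2 : Tendsto (fun R : ℝ => C * Real.exp (-d * Real.exp (-R)) * Real.exp (-R) *
        |ε - -ε|) atTop (nhds (C * Real.exp (-d * 0) * 0 * |ε - -ε|)) :=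
      ((((Real.continuous_exp.tendsto _).comp (h1.const_mul (-d))).const_mul C).mul h1).mul_const _
    simp only [mul_zero, zero_mul] at h2
    exact squeeze_zero_norm (fun R => hside (-R)) h2
  have hε' : |ε| ≤ ε := (abs_of_nonneg hε0).le
  have htot := (((hlim (-ε) (by rwa [abs_neg])).sub (hlim ε hε')).add
    (hside1.const_smul I)).sub (hside2.const_smul I)
  have hzero := tendsto_nhds_unique (htot.congr hrect) tendsto_const_nhds
  simp only [smul_zero, add_zero, sub_zero, ofReal_neg, neg_mul] at hzero
  exact (sub_eq_zero.1 hzero).symm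

end Sector

lemma exists_calG_mul_exp_bound {p : ℕ} {τ : ℝ} (hτ : 0 < τ) {a b : Fin p → ℂ}
    (hab : ∑ j, a j = ∑ j, b j) {c : ℝ} (hc : ∀ j, (b j).re - τ - 1 < c) {k : ℝ} (hk : 0 < k)
    (hk1 : k ≤ 1) {L : ℝ} (hL : 0 < L) :
    ∃ C, ∀ σ : ℂ, k * ‖σ‖ ≤ σ.re →
      ‖calG 0 p a b (c + σ) τ * exp (-((c + σ) * L))‖ ≤ C * Real.exp (-(k * L / 2) * ‖σ‖) := by
  obtain ⟨C, hC, h⟩ := exists_norm_prod_barnesG_ratio_le (u := fun j => 1 + τ - a j + c)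
    (v := fun j => 1 + τ - b j + c) (by simp [Finset.sum_add_distrib, hab])
    (fun j => by have := hc j; simp; linarith) hτ hk hk1 (δ := k * L / 2) (by positivity)
  refine ⟨C * Real.exp (-(c * L)), fun σ hσ => ?_⟩
  have hG : calG 0 p a b (c + σ) τ = (∏ j, barnesG (σ + (1 + τ - a j + c)) τ) /
      ∏ j, barnesG (σ + (1 + τ - b j + c)) τ := by
    rw [calG_zero_eq]
    congr 1 <;> refine Finset.prod_congr rfl fun j _ => ?_ <;> congr 1 <;> ring
  have hre : (-(((c : ℂ) + σ) * L)).re = -((c + σ.re) * L) := by simp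
  rw [norm_mul, norm_exp, hG, hre]
  calc _ ≤ C * Real.exp (k * L / 2 * ‖σ‖) * Real.exp (-((c + k * ‖σ‖) * L)) := by
        gcongr
        exact h σ hσ
    _ = _ := by
        rw [mul_assoc, mul_assoc, ← Real.exp_add, ← Real.exp_add]
        ring_nf

lemma differentiableAt_calG {p : ℕ} {τ : ℝ} (hτ : 0 < τ) {a b : Fin p → ℂ} {s : ℂ}
    (hs : ∀ j, (b j).re - τ - 1 < s.re) :
    DifferentiableAt ℂ (fun s => calG 0 p a b s τ) s := by
  simp only [calG_zero_eq]
  have hd : ∀ u : ℂ, Differentiable ℂ fun s => barnesG (u + s) τ := fun u =>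
    (differentiable_barnesG hτ).comp (by fun_prop)
  refine DifferentiableAt.div (DifferentiableAt.fun_finsetProd fun j _ => hd _ s)
    (DifferentiableAt.fun_finsetProd fun j _ => hd _ s) ?_
  refine Finset.prod_ne_zero_iff.2 fun j _ => barnesG_ne_zero hτ ?_
  have := hs j
  simp
  linarith

/-- Vanishing of `K^{0,p}_{p,p}(a;b|z;τ)` for `z > 1` in the logarithmic case. -/
theorem Kfun_logcase_vanishes_right {p : ℕ} (hp : 1 ≤ p) (τ : ℝ) (hτ : 0 < τ)
    (a b : Fin p → ℂ) (hab : ∑ j, a j = ∑ j, b j)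
    (ε : ℝ) (hε : ε ∈ Set.Ioo 0 (Real.pi / 2))
    (c : ℝ) (hc : ∀ j : Fin p, (b j).re - τ - 1 < c)
    (z : ℝ) (hz : 1 < z) :
    MeasureTheory.IntegrableOn (fun t : ℝ =>
        calG 0 p a b ((c : ℂ) + t * Complex.exp ((ε : ℂ) * Complex.I)) (τ : ℂ) *
          Complex.exp (-(((c : ℂ) + t * Complex.exp ((ε : ℂ) * Complex.I)) * Real.log z)))
      (Set.Ioi 0) ∧
    MeasureTheory.IntegrableOn (fun t : ℝ =>
        calG 0 p a b ((c : ℂ) + t * Complex.exp (-((ε : ℂ) * Complex.I))) (τ : ℂ) *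
          Complex.exp (-(((c : ℂ) + t * Complex.exp (-((ε : ℂ) * Complex.I))) * Real.log z)))
      (Set.Ioi 0) ∧
    1 / (2 * Real.pi * Complex.I) *
        (Complex.exp ((ε : ℂ) * Complex.I) *
            (∫ t in Set.Ioi (0 : ℝ),
              calG 0 p a b ((c : ℂ) + t * Complex.exp ((ε : ℂ) * Complex.I)) (τ : ℂ) *
                Complex.exp (-(((c : ℂ) + t * Complex.exp ((ε : ℂ) * Complex.I)) * Real.log z)))
          - Complex.exp (-((ε : ℂ) * Complex.I)) *
            (∫ t in Set.Ioi (0 : ℝ),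
              calG 0 p a b ((c : ℂ) + t * Complex.exp (-((ε : ℂ) * Complex.I))) (τ : ℂ) *
                Complex.exp (-(((c : ℂ) + t * Complex.exp (-((ε : ℂ) * Complex.I)))
                  * Real.log z)))) = 0 := by
  have hk : 0 < Real.cos ε := Real.cos_pos_of_mem_Ioo ⟨by linarith [hε.1, Real.pi_pos], hε.2⟩
  have hL : 0 < Real.log z := Real.log_pos hz
  have hεπ : ε ≤ Real.pi := by linarith [hε.2, Real.pi_pos]
  obtain ⟨C, hC⟩ := exists_calG_mul_exp_bound hτ hab hc hk (Real.cos_le_one ε) hL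
  have hd : 0 < Real.cos ε * Real.log z / 2 := by positivity
  have hf : ∀ σ : ℂ, Real.cos ε * ‖σ‖ ≤ σ.re → DifferentiableAt ℂ
      (fun σ => calG 0 p a b (c + σ) τ * exp (-((c + σ) * Real.log z))) σ := fun σ hσ => by
    refine DifferentiableAt.mul ?_ (by fun_prop)
    refine (differentiableAt_calG hτ (s := c + σ) fun j => ?_).comp σ
      (f := fun σ : ℂ => (c : ℂ) + σ) (by fun_prop)
    have := hc j
    have : 0 ≤ Real.cos ε * ‖σ‖ := by positivity
    simp
    linarith
  have hpos := integrableOn_ray hεπ hf hd hC (abs_of_pos hε.1).le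
  have hneg := integrableOn_ray hεπ hf hd hC (θ := -ε) (by rw [abs_neg, abs_of_pos hε.1])
  simp only [ofReal_neg, neg_mul] at hneg
  refine ⟨hpos, hneg, ?_⟩
  rw [integral_ray_eq hε.1.le hεπ hf hd hC, sub_self, mul_zero]
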